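/- Let T be a multi-truncation on a vector lattice L and let Q be a nonempty set of proper prime ideals of L. For every f ∈ L⁺ and every P ∈ Q_T with f ∉ P, there exist a truncation * ∈ T and h ∈ L⁺ such that h* ∉ P and [Q_T]_{h*} ⊆ [Q_T]_f, i.e., every Q' ∈ Q_T with h* ∉ Q' satisfies f ∉ Q'. Consequently, the sets [Q]_{f*} (* ∈ T, f ∈ L⁺) form a base of the hull-kernel topology on Q_T. -/

import Mathlib

/-- A truncation on a vector lattice `L`: a map sending each positive element to a
positive element, not identically zero on the positive cone, satisfying
(a) `f ⊓ g* ≤ f* ≤ f` for all `f, g ∈ L⁺`, and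
(b) if `f ∈ L⁺` and `(n • f)* = n • f` for all `n ≥ 1`, then `f = 0`. -/
structure Truncation (L : Type*) [Lattice L] [AddCommGroup L] where
  toFun : L → L
  map_nonneg' : ∀ f : L, 0 ≤ f → 0 ≤ toFun f
  nonzero' : ∃ f : L, 0 ≤ f ∧ toFun f ≠ 0
  inf_le' : ∀ f g : L, 0 ≤ f → 0 ≤ g → f ⊓ toFun g ≤ toFun f
  le_self' : ∀ f : L, 0 ≤ f → toFun f ≤ f
  arch' : ∀ f : L, 0 ≤ f → (∀ n : ℕ, 1 ≤ n → toFun (n • f) = n • f) → f = 0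

/-- An (order) ideal of a vector lattice: a vector subspace which is solid. -/
def IsLatticeIdeal {L : Type*} [Lattice L] [AddCommGroup L] [Module ℝ L]
    (P : Submodule ℝ L) : Prop :=
  ∀ f ∈ P, ∀ g : L, |g| ≤ |f| → g ∈ P

/-- A proper prime ideal of a vector lattice: a solid vector subspace `P ≠ L`
such that `f ⊓ g ∈ P` implies `f ∈ P` or `g ∈ P`. -/
def IsProperPrimeIdeal {L : Type*} [Lattice L] [AddCommGroup L] [Module ℝ L]
    (P : Submodule ℝ L) : Prop :=
  IsLatticeIdeal P ∧ P ≠ ⊤ ∧ ∀ f g : L, f ⊓ g ∈ P → f ∈ P ∨ g ∈ P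

/-- A multi-truncation on `L`: a family of truncations with pairwise disjoint ranges. -/
def IsMultiTruncation {L : Type*} [Lattice L] [AddCommGroup L]
    (T : Set (Truncation L)) : Prop :=
  ∀ s ∈ T, ∀ r ∈ T, s ≠ r → ∀ f : L, 0 ≤ f → s.toFun f ⊓ r.toFun f = 0

/-- The hull-kernel topology on a set `X` of ideals of `L`, generated by the sets
`[X]_f = {P ∈ X : f ∉ P}` for `f ∈ L⁺`. -/
def hullKernel {L : Type*} [Lattice L] [AddCommGroup L] [Module ℝ L]
    (X : Set (Submodule ℝ L)) : TopologicalSpace X :=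
  TopologicalSpace.generateFrom {S : Set X | ∃ f : L, 0 ≤ f ∧ S = {P : X | f ∉ P.1}}

/-- `Q* = ⋃_{f ∈ L⁺} [Q]_{f*}`, the set of `P ∈ Q` omitting `f*` for some `f ∈ L⁺`. -/
def Qstar {L : Type*} [Lattice L] [AddCommGroup L] [Module ℝ L]
    (Q : Set (Submodule ℝ L)) (t : Truncation L) : Set (Submodule ℝ L) :=
  {P | P ∈ Q ∧ ∃ f : L, 0 ≤ f ∧ t.toFun f ∉ P}

/-- `Q_T = ⋃_{* ∈ T} Q*`. -/
def QT {L : Type*} [Lattice L] [AddCommGroup L] [Module ℝ L]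
    (Q : Set (Submodule ℝ L)) (T : Set (Truncation L)) : Set (Submodule ℝ L) :=
  ⋃ t ∈ T, Qstar Q t

section

variable {L : Type*} [Lattice L] [AddCommGroup L]

/-- A positive element lying below some truncated element is fixed by the truncation. -/
theorem Truncation.toFun_eq_self_of_le (t : Truncation L) {h g : L} (hh : 0 ≤ h) (hg : 0 ≤ g)
    (hle : h ≤ t.toFun g) : t.toFun h = h :=
  le_antisymm (t.le_self' h hh) (by simpa [inf_eq_left.2 hle] using t.inf_le' h g hh hg)

variable [Module ℝ L]

theorem mem_QT {Q : Set (Submodule ℝ L)} {T : Set (Truncation L)} {P : Submodule ℝ L} :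
    P ∈ QT Q T ↔ ∃ t ∈ T, P ∈ Q ∧ ∃ f : L, 0 ≤ f ∧ t.toFun f ∉ P := by
  simp only [QT, Qstar, Set.mem_iUnion, Set.mem_ofPred_eq, exists_prop]

variable [CovariantClass L L (· + ·) (· ≤ ·)]

theorem IsLatticeIdeal.mem_of_nonneg_of_le {P : Submodule ℝ L} (hP : IsLatticeIdeal P) {f g : L}
    (hf : f ∈ P) (hg : 0 ≤ g) (hle : g ≤ f) : g ∈ P :=
  hP f hf g (by rwa [abs_of_nonneg hg, abs_of_nonneg (hg.trans hle)])

theorem IsProperPrimeIdeal.inf_mem_iff {P : Submodule ℝ L} (hP : IsProperPrimeIdeal P) {f g : L}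
    (hf : 0 ≤ f) (hg : 0 ≤ g) : f ⊓ g ∈ P ↔ f ∈ P ∨ g ∈ P :=
  ⟨hP.2.2 f g, fun h => h.elim
    (fun h => hP.1.mem_of_nonneg_of_le h (le_inf hf hg) inf_le_left)
    (fun h => hP.1.mem_of_nonneg_of_le h (le_inf hf hg) inf_le_right)⟩

theorem exists_truncation_notMem {T : Set (Truncation L)} {Q : Set (Submodule ℝ L)}
    (hQ : ∀ P ∈ Q, IsProperPrimeIdeal P) {f : L} (hf : 0 ≤ f) {P : Submodule ℝ L}
    (hP : P ∈ QT Q T) (hfP : f ∉ P) :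
    ∃ t ∈ T, ∃ h : L, 0 ≤ h ∧ t.toFun h ∉ P ∧ ∀ Q' ∈ QT Q T, t.toFun h ∉ Q' → f ∉ Q' := by
  obtain ⟨t, ht, hPQ, g, hg, hgP⟩ := mem_QT.1 hP
  have htg := t.map_nonneg' g hg
  have hh : 0 ≤ f ⊓ t.toFun g := le_inf hf htg
  refine ⟨t, ht, f ⊓ t.toFun g, hh, ?_⟩
  rw [t.toFun_eq_self_of_le hh hg inf_le_right]
  refine ⟨fun hmem => ((hQ P hPQ).2.2 _ _ hmem).elim hfP hgP, fun Q' hQ' hn hfQ' => hn ?_⟩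
  obtain ⟨-, -, hQ'Q, -⟩ := mem_QT.1 hQ'
  exact ((hQ Q' hQ'Q).inf_mem_iff hf htg).2 (Or.inl hfQ')

end

/-- Let `T` be a multi-truncation on a vector lattice `L` and `Q` a nonempty set of proper
prime ideals of `L`. For every `f ∈ L⁺` and `P ∈ Q_T` with `f ∉ P`, there exist `* ∈ T`
and `h ∈ L⁺` with `h* ∉ P` and `[Q_T]_{h*} ⊆ [Q_T]_f`; consequently the sets `[Q]_{f*}`
(`* ∈ T`, `f ∈ L⁺`) form a base of the hull-kernel topology on `Q_T`. -/
theorem stmt_13 {L : Type*} [Lattice L] [AddCommGroup L]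
    [CovariantClass L L (· + ·) (· ≤ ·)] [Module ℝ L] [PosSMulMono ℝ L]
    (T : Set (Truncation L)) (hT : IsMultiTruncation T)
    (Q : Set (Submodule ℝ L)) (hQne : Q.Nonempty)
    (hQ : ∀ P ∈ Q, IsProperPrimeIdeal P) :
    (∀ f : L, 0 ≤ f → ∀ P ∈ QT Q T, f ∉ P →
      ∃ t ∈ T, ∃ h : L, 0 ≤ h ∧ t.toFun h ∉ P ∧
        ∀ Q' ∈ QT Q T, t.toFun h ∉ Q' → f ∉ Q') ∧
      @TopologicalSpace.IsTopologicalBasis _ (hullKernel (QT Q T))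
        {S : Set (QT Q T) | ∃ t ∈ T, ∃ f : L, 0 ≤ f ∧ S = {P : QT Q T | t.toFun f ∉ P.1}} := by
  refine ⟨fun f hf P hP hfP => exists_truncation_notMem hQ hf hP hfP, ?_⟩
  let _ : TopologicalSpace (QT Q T) := hullKernel (QT Q T)
  refine TopologicalSpace.isTopologicalBasis_of_isOpen_of_nhds ?_ ?_
  · rintro _ ⟨t, -, f, hf, rfl⟩
    exact TopologicalSpace.isOpen_generateFrom_of_mem ⟨t.toFun f, t.map_nonneg' f hf, rfl⟩
  · intro P U hPU hU
    change TopologicalSpace.GenerateOpen _ U at hU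
    induction hU with
    | basic S hS =>
      obtain ⟨f, hf, rfl⟩ := hS
      obtain ⟨t, ht, h, hh, hhP, hsub⟩ := exists_truncation_notMem hQ hf P.2 hPU
      exact ⟨_, ⟨t, ht, h, hh, rfl⟩, hhP, fun Q' hQ' => hsub Q'.1 Q'.2 hQ'⟩
    | univ =>
      obtain ⟨t, ht, -, f, hf, hfP⟩ := mem_QT.1 P.2
      exact ⟨_, ⟨t, ht, f, hf, rfl⟩, hfP, Set.subset_univ _⟩
    | inter U V _ _ ihU ihV =>
      obtain ⟨_, ⟨s, hs, f, hf, rfl⟩, hfP, hfU⟩ := ihU hPU.1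
      obtain ⟨_, ⟨r, hr, g, hg, rfl⟩, hgP, hgV⟩ := ihV hPU.2
      have hsf := s.map_nonneg' f hf
      have hrg := r.map_nonneg' g hg
      have hprime (R : QT Q T) :
          s.toFun f ⊓ r.toFun g ∈ R.1 ↔ s.toFun f ∈ R.1 ∨ r.toFun g ∈ R.1 :=
        have ⟨_, _, hRQ, _⟩ := mem_QT.1 R.2
        (hQ R.1 hRQ).inf_mem_iff hsf hrg
      obtain ⟨t, ht, h, hh, hhP, hsub⟩ := exists_truncation_notMem hQ (le_inf hsf hrg) P.2
        (fun hmem => ((hprime P).1 hmem).elim hfP hgP)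
      refine ⟨_, ⟨t, ht, h, hh, rfl⟩, hhP, fun R hR => ?_⟩
      have hR' := hsub R.1 R.2 hR
      rw [hprime, not_or] at hR'
      exact ⟨hfU hR'.1, hgV hR'.2⟩
    | sUnion 𝒮 _ ih =>
      obtain ⟨U, hU, hPU⟩ := hPU
      obtain ⟨V, hV, hPV, hVU⟩ := ih U hU hPU
      exact ⟨V, hV, hPV, hVU.trans (Set.subset_sUnion_of_mem hU)⟩
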